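/- Let Ω ⊂ ℝⁿ be a bounded open convex set with diameter d, let p > 1, and let u be a continuous function on the closure of Ω with ∫_Ω |u(x)|^(p-2) u(x) dx = 0. Then for every ε > 0 there exist finitely many pairwise disjoint open convex sets Ω₁, …, Ω_k ⊆ Ω such that the union of their closures is the closure of Ω, ∫_{Ω_i} |u(x)|^(p-2) u(x) dx = 0 for each i, and for each i there exists a rigid motion (an isometry of ℝⁿ) T_i and a number d_i ≤ d such that T_i(Ω_i) ⊆ {(x₁, …, x_n) ∈ ℝⁿ : 0 ≤ x₁ ≤ d_i and |x_ℓ| ≤ ε for ℓ = 2, …, n}. -/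

import Mathlib

open MeasureTheory

section Slicing

variable {E : Type*} [NormedAddCommGroup E] [NormedSpace ℝ E]

/-- `HyperplaneSlicing Q C` says that finitely many successive cuts by hyperplanes decompose `C`
into sets satisfying `Q`. -/
inductive HyperplaneSlicing (Q : Set E → Prop) : Set E → Prop
  | leaf {C : Set E} : Q C → HyperplaneSlicing Q C
  | cut {C : Set E} (ℓ : StrongDual ℝ E) (t : ℝ) : ℓ ≠ 0 →
      HyperplaneSlicing Q (C ∩ {x | ℓ x < t}) → HyperplaneSlicing Q (C ∩ {x | t < ℓ x}) →
      HyperplaneSlicing Q C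

theorem HyperplaneSlicing.bind {Q R : Set E → Prop} {C : Set E} (h : HyperplaneSlicing Q C)
    (hQR : ∀ D, Q D → HyperplaneSlicing R D) : HyperplaneSlicing R C := by
  induction h with
  | leaf hC => exact hQR _ hC
  | cut ℓ t hℓ _ _ ih₁ ih₂ => exact .cut ℓ t hℓ ih₁ ih₂

theorem dense_setOf_apply_ne {ℓ : StrongDual ℝ E} (hℓ : ℓ ≠ 0) (t : ℝ) :
    Dense {x | ℓ x ≠ t} := by
  have hsurj : Function.Surjective ℓ := LinearMap.surjective (f := ℓ.toLinearMap)
    (fun h => hℓ (ContinuousLinearMap.coe_injective h))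
  exact (dense_compl_singleton t).preimage (ℓ.isOpenMap_of_ne_zero hℓ)

theorem closure_inter_halfSpaces {C : Set E} (hC : IsOpen C) {ℓ : StrongDual ℝ E} (hℓ : ℓ ≠ 0)
    (t : ℝ) : closure (C ∩ {x | ℓ x < t}) ∪ closure (C ∩ {x | t < ℓ x}) = closure C := by
  rw [← closure_union, ← Set.inter_union_distrib_left]
  have : {x | ℓ x < t} ∪ {x | t < ℓ x} = {x | ℓ x ≠ t} := by
    ext x; exact lt_or_lt_iff_ne (a := ℓ x)
  rw [this]
  exact (closure_mono Set.inter_subset_left).antisymm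
    (closure_minimal ((dense_setOf_apply_ne hℓ t).open_subset_closure_inter hC) isClosed_closure)

theorem isOpen_inter_lt {C : Set E} (hC : IsOpen C) (ℓ : StrongDual ℝ E) (t : ℝ) :
    IsOpen (C ∩ {x | ℓ x < t}) :=
  hC.inter (isOpen_lt ℓ.continuous continuous_const)

theorem isOpen_inter_gt {C : Set E} (hC : IsOpen C) (ℓ : StrongDual ℝ E) (t : ℝ) :
    IsOpen (C ∩ {x | t < ℓ x}) :=
  hC.inter (isOpen_lt continuous_const ℓ.continuous)

theorem HyperplaneSlicing.exists_finite {Q : Set E → Prop} {C : Set E}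
    (h : HyperplaneSlicing Q C) (hC : IsOpen C) :
    ∃ S : Set (Set E), S.Finite ∧ (∀ D ∈ S, D ⊆ C ∧ Q D) ∧ S.PairwiseDisjoint id ∧
      (⋃ D ∈ S, closure D) = closure C := by
  induction h with
  | @leaf C hQ => exact ⟨{C}, Set.finite_singleton C, by simpa using hQ, by simp, by simp⟩
  | @cut C ℓ t hℓ _ _ ih₁ ih₂ =>
    obtain ⟨S₁, hf₁, h₁, hd₁, hc₁⟩ := ih₁ (isOpen_inter_lt hC ℓ t)
    obtain ⟨S₂, hf₂, h₂, hd₂, hc₂⟩ := ih₂ (isOpen_inter_gt hC ℓ t)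
    refine ⟨S₁ ∪ S₂, hf₁.union hf₂, ?_, ?_, ?_⟩
    · rintro D (hD | hD)
      · exact ⟨(h₁ D hD).1.trans Set.inter_subset_left, (h₁ D hD).2⟩
      · exact ⟨(h₂ D hD).1.trans Set.inter_subset_left, (h₂ D hD).2⟩
    · refine Set.pairwiseDisjoint_union.2 ⟨hd₁, hd₂, fun D₁ hD₁ D₂ hD₂ _ => ?_⟩
      refine Set.disjoint_left.2 fun x hx₁ hx₂ => ?_
      exact lt_asymm (a := ℓ x) ((h₁ D₁ hD₁).1 hx₁).2 ((h₂ D₂ hD₂).1 hx₂).2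
    · rw [Set.biUnion_union, hc₁, hc₂, closure_inter_halfSpaces hC hℓ]

theorem Convex.exists_sq_add_sq_eq_one_of_interior_eq_empty {S : Set (ℝ × ℝ)}
    (hS : Convex ℝ S) (hint : interior S = ∅) :
    ∃ c s t : ℝ, c ^ 2 + s ^ 2 = 1 ∧ ∀ y ∈ S, c * y.1 + s * y.2 = t := by
  rcases S.eq_empty_or_nonempty with rfl | ⟨y₀, hy₀⟩
  · exact ⟨1, 0, 0, by norm_num, by simp⟩
  have hspan : affineSpan ℝ S ≠ ⊤ := fun h =>
    (hS.interior_nonempty_iff_affineSpan_eq_top.2 h).ne_empty hint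
  have hdir : (affineSpan ℝ S).direction < ⊤ := by
    refine lt_top_iff_ne_top.2 fun h => hspan ?_
    exact (AffineSubspace.direction_eq_top_iff_of_nonempty ⟨y₀, subset_affineSpan ℝ S hy₀⟩).1 h
  obtain ⟨g, hg, hker⟩ := Submodule.exists_le_ker_of_lt_top _ hdir
  have hgy (y : ℝ × ℝ) : g y = g (1, 0) * y.1 + g (0, 1) * y.2 := by
    have : y = y.1 • ((1 : ℝ), (0 : ℝ)) + y.2 • ((0 : ℝ), (1 : ℝ)) := by ext <;> simp
    conv_lhs => rw [this, map_add, map_smul, map_smul]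
    simp [mul_comm]
  have hpos : 0 < g (1, 0) ^ 2 + g (0, 1) ^ 2 := by
    by_contra! h
    have h₁ : g (1, 0) = 0 := by nlinarith [sq_nonneg (g (1, 0)), sq_nonneg (g (0, 1))]
    have h₂ : g (0, 1) = 0 := by nlinarith [sq_nonneg (g (1, 0)), sq_nonneg (g (0, 1))]
    exact hg (LinearMap.ext fun y => by rw [hgy, h₁, h₂]; simp)
  set r := √(g (1, 0) ^ 2 + g (0, 1) ^ 2) with hr
  have hr0 : r ≠ 0 := (Real.sqrt_pos.2 hpos).ne'
  have hr2 : r ^ 2 = g (1, 0) ^ 2 + g (0, 1) ^ 2 := Real.sq_sqrt hpos.le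
  refine ⟨g (1, 0) / r, g (0, 1) / r, g y₀ / r, ?_, fun y hy => ?_⟩
  · rw [div_pow, div_pow, ← add_div, ← hr2, div_self (pow_ne_zero 2 hr0)]
  · have : g (y - y₀) = 0 := hker (AffineSubspace.vsub_mem_direction
      (subset_affineSpan ℝ S hy) (subset_affineSpan ℝ S hy₀))
    rw [map_sub, sub_eq_zero] at this
    rw [← this, hgy y]
    ring

theorem notMem_interior_of_forall_le {S : Set (ℝ × ℝ)} {c s : ℝ} (hcs : c ^ 2 + s ^ 2 = 1)
    {q : ℝ × ℝ} (h : ∀ y ∈ S, c * q.1 + s * q.2 ≤ c * y.1 + s * y.2) : q ∉ interior S := by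
  intro hq
  have hcont : ContinuousAt (fun r : ℝ => (q.1 - r * c, q.2 - r * s)) 0 := by fun_prop
  have hmem : ∀ᶠ r in nhds (0 : ℝ), (q.1 - r * c, q.2 - r * s) ∈ S :=
    hcont.eventually (by simpa using mem_interior_iff_mem_nhds.1 hq)
  obtain ⟨r, hr, hr0⟩ := ((hmem.filter_mono nhdsWithin_le_nhds).and
    (self_mem_nhdsWithin (s := Set.Ioi (0 : ℝ)))).exists
  have := h _ hr
  have hr0' : 0 < r := hr0
  nlinarith

theorem LinearIndependent.smul_add_smul_ne_zero {A B : StrongDual ℝ E}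
    (hAB : LinearIndependent ℝ ![A, B]) {c s : ℝ} (hcs : c ^ 2 + s ^ 2 = 1) :
    c • A + s • B ≠ 0 := by
  intro h
  obtain ⟨rfl, rfl⟩ := LinearIndependent.pair_iff.1 hAB c s h
  norm_num at hcs

variable [MeasurableSpace E] [BorelSpace E] [FiniteDimensional ℝ E]

theorem addHaar_setOf_apply_eq (μ : Measure E) [μ.IsAddHaarMeasure] {ℓ : StrongDual ℝ E}
    (hℓ : ℓ ≠ 0) (t : ℝ) : μ {x | ℓ x = t} = 0 := by
  obtain ⟨x₀, hx₀⟩ : ∃ x₀, ℓ x₀ = t := LinearMap.surjective (f := ℓ.toLinearMap)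
    (fun h => hℓ (ContinuousLinearMap.coe_injective h)) t
  have hker : ℓ.toLinearMap.ker ≠ ⊤ := fun h =>
    hℓ (ContinuousLinearMap.coe_injective (LinearMap.ker_eq_top.1 h))
  have : {x | ℓ x = t} = (fun x => x + -x₀) ⁻¹' (ℓ.toLinearMap.ker : Set E) := by
    ext x
    simp [← hx₀, ← sub_eq_add_neg, sub_eq_zero]
  rw [this, measure_preimage_add_right, Measure.addHaar_submodule μ _ hker]

/-- Bounded open convex sets on which the integral of `f` vanishes. -/
structure IsBalanced (μ : Measure E) (f : E → ℝ) (C : Set E) : Prop where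
  isOpen : IsOpen C
  convex : Convex ℝ C
  isBounded : Bornology.IsBounded C
  integrableOn : IntegrableOn f C μ
  integral_eq_zero : ∫ x in C, f x ∂μ = 0

variable {μ : Measure E} [μ.IsAddHaarMeasure] {f : E → ℝ} {C : Set E}

theorem setIntegral_inter_halfSpaces (hf : IntegrableOn f C μ)
    {ℓ : StrongDual ℝ E} (hℓ : ℓ ≠ 0) (t : ℝ) :
    (∫ x in C ∩ {x | ℓ x < t}, f x ∂μ) + ∫ x in C ∩ {x | t < ℓ x}, f x ∂μ =
      ∫ x in C, f x ∂μ := by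
  have hlt : MeasurableSet {x | ℓ x < t} := (isOpen_lt ℓ.continuous continuous_const).measurableSet
  rw [← integral_inter_add_sdiff hlt hf]
  congr 1
  refine setIntegral_congr_set ?_
  have hne : ∀ᵐ x ∂μ, ℓ x ≠ t := by
    rw [ae_iff]; simpa using addHaar_setOf_apply_eq μ hℓ t
  filter_upwards [hne] with x hx
  refine propext (and_congr_right fun _ => ?_)
  change t < ℓ x ↔ ¬ ℓ x < t
  rw [not_lt]
  exact ⟨le_of_lt, fun h => lt_of_le_of_ne h hx.symm⟩

theorem continuous_setIntegral_rotating_halfSpace (hf : IntegrableOn f C μ)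
    {A B : StrongDual ℝ E} (hAB : LinearIndependent ℝ ![A, B]) (q : ℝ × ℝ) :
    Continuous fun θ : ℝ => ∫ x in C ∩ {x | Real.cos θ * q.1 + Real.sin θ * q.2 <
      (Real.cos θ • A + Real.sin θ • B) x}, f x ∂μ := by
  have hmeas (θ : ℝ) : MeasurableSet {x | Real.cos θ * q.1 + Real.sin θ * q.2 <
      (Real.cos θ • A + Real.sin θ • B) x} :=
    (isOpen_lt continuous_const (ContinuousLinearMap.continuous _)).measurableSet
  simp_rw [← setIntegral_indicator (hmeas _)]
  refine continuous_iff_continuousAt.2 fun θ₀ => continuousAt_of_dominated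
    (bound := fun x => ‖f x‖) (.of_forall fun θ => hf.aestronglyMeasurable.indicator (hmeas θ))
    (.of_forall fun θ => .of_forall fun x => norm_indicator_le_norm_self f x) hf.norm ?_
  have hne : ∀ᵐ x ∂μ, (Real.cos θ₀ • A + Real.sin θ₀ • B) x ≠
      Real.cos θ₀ * q.1 + Real.sin θ₀ * q.2 := by
    rw [ae_iff]
    simpa using addHaar_setOf_apply_eq μ
      (hAB.smul_add_smul_ne_zero (Real.cos_sq_add_sin_sq θ₀)) _
  filter_upwards [ae_restrict_of_ae hne] with x hx
  have hl : Continuous fun θ : ℝ => Real.cos θ * q.1 + Real.sin θ * q.2 := by fun_prop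
  have hr : Continuous fun θ : ℝ => (Real.cos θ • A + Real.sin θ • B) x := by
    simp only [add_apply, smul_apply, smul_eq_mul]
    fun_prop
  rcases lt_or_gt_of_ne hx with h | h
  · refine (continuousAt_const (y := (0 : ℝ))).congr ?_
    filter_upwards [(isOpen_lt hr hl).mem_nhds h] with θ hθ
    exact (Set.indicator_of_notMem (s := {x | Real.cos θ * q.1 + Real.sin θ * q.2 <
      (Real.cos θ • A + Real.sin θ • B) x}) (not_lt.2 (le_of_lt hθ)) f).symm
  · refine (continuousAt_const (y := f x)).congr ?_
    filter_upwards [(isOpen_lt hl hr).mem_nhds h] with θ hθ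
    exact (Set.indicator_of_mem (s := {x | Real.cos θ * q.1 + Real.sin θ * q.2 <
      (Real.cos θ • A + Real.sin θ • B) x}) hθ f).symm

theorem IsBalanced.exists_cut (hC : IsBalanced μ f C)
    {A B : StrongDual ℝ E} (hAB : LinearIndependent ℝ ![A, B]) (q : ℝ × ℝ) :
    ∃ c s : ℝ, c ^ 2 + s ^ 2 = 1 ∧
      IsBalanced μ f (C ∩ {x | (c • A + s • B) x < c * q.1 + s * q.2}) ∧
      IsBalanced μ f (C ∩ {x | c * q.1 + s * q.2 < (c • A + s • B) x}) := by
  set I : ℝ → ℝ := fun θ => ∫ x in C ∩ {x | Real.cos θ * q.1 + Real.sin θ * q.2 <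
      (Real.cos θ • A + Real.sin θ • B) x}, f x ∂μ with hI
  have hIcont : Continuous I := continuous_setIntegral_rotating_halfSpace hC.integrableOn hAB q
  have hA : A ≠ 0 := hAB.ne_zero 0
  have hsum : I Real.pi + I 0 = 0 := by
    have := setIntegral_inter_halfSpaces (μ := μ) hC.integrableOn hA q.1
    rw [hC.integral_eq_zero] at this
    simpa [hI] using this
  obtain ⟨θ, hθ⟩ : (0 : ℝ) ∈ Set.range I := by
    rcases le_total (I 0) 0 with h | h
    · exact mem_range_of_exists_le_of_exists_ge hIcont ⟨0, h⟩ ⟨Real.pi, by linarith⟩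
    · exact mem_range_of_exists_le_of_exists_ge hIcont ⟨Real.pi, by linarith⟩ ⟨0, h⟩
  have hcs := Real.cos_sq_add_sin_sq θ
  have hlt := setIntegral_inter_halfSpaces (μ := μ) hC.integrableOn
    (hAB.smul_add_smul_ne_zero hcs) (Real.cos θ * q.1 + Real.sin θ * q.2)
  rw [hC.integral_eq_zero] at hlt
  simp only [hI] at hθ
  rw [hθ, add_zero] at hlt
  refine ⟨Real.cos θ, Real.sin θ, hcs, ⟨isOpen_inter_lt hC.isOpen _ _, ?_, ?_, ?_, hlt⟩,
    ⟨isOpen_inter_gt hC.isOpen _ _, ?_, ?_, ?_, hθ⟩⟩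
  · exact hC.convex.inter (convex_halfSpace_lt (LinearMap.isLinear (ContinuousLinearMap.toLinearMap
      (Real.cos θ • A + Real.sin θ • B))) _)
  · exact hC.isBounded.subset Set.inter_subset_left
  · exact hC.integrableOn.mono_set Set.inter_subset_left
  · exact hC.convex.inter (convex_halfSpace_gt (LinearMap.isLinear (ContinuousLinearMap.toLinearMap
      (Real.cos θ • A + Real.sin θ • B))) _)
  · exact hC.isBounded.subset Set.inter_subset_left
  · exact hC.integrableOn.mono_set Set.inter_subset_left

/-- A balanced set can be sliced by hyperplanes with normals in a given plane until every piece
is thin in a direction of that plane. One cuts successively through all points of a dense sequence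
of the plane; along a sequence of nested pieces that never become sliceable, the projection of the
intersection to the plane has empty interior. -/
theorem IsBalanced.hyperplaneSlicing_of_linearIndependent (hC : IsBalanced μ f C)
    {A B : StrongDual ℝ E} (hAB : LinearIndependent ℝ ![A, B]) {ε : ℝ} (hε : 0 < ε) :
    HyperplaneSlicing (fun D => IsBalanced μ f D ∧ D ⊆ C ∧ ∃ c s t : ℝ, c ^ 2 + s ^ 2 = 1 ∧
      ∀ x ∈ D, |c * A x + s * B x - t| ≤ ε) C := by
  set Q : Set E → Prop := fun D => IsBalanced μ f D ∧ D ⊆ C ∧ ∃ c s t : ℝ, c ^ 2 + s ^ 2 = 1 ∧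
      ∀ x ∈ D, |c * A x + s * B x - t| ≤ ε
  by_contra hbad
  let X := {D : Set E // IsBalanced μ f D ∧ D ⊆ C ∧ ¬ HyperplaneSlicing Q D}
  have hstep (j : ℕ) (D : X) : ∃ D' : X, D'.1 ⊆ D.1 ∧ ∃ c s : ℝ, c ^ 2 + s ^ 2 = 1 ∧
      ∀ x ∈ D'.1, c * (TopologicalSpace.denseSeq (ℝ × ℝ) j).1 +
        s * (TopologicalSpace.denseSeq (ℝ × ℝ) j).2 ≤ c * A x + s * B x := by
    obtain ⟨D, hD, hDC, hDbad⟩ := D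
    set q := TopologicalSpace.denseSeq (ℝ × ℝ) j
    obtain ⟨c, s, hcs, h₁, h₂⟩ := hD.exists_cut hAB q
    by_cases hs₁ : HyperplaneSlicing Q (D ∩ {x | (c • A + s • B) x < c * q.1 + s * q.2})
    · have hs₂ : ¬ HyperplaneSlicing Q (D ∩ {x | c * q.1 + s * q.2 < (c • A + s • B) x}) :=
        fun hs₂ => hDbad (.cut _ _ (hAB.smul_add_smul_ne_zero hcs) hs₁ hs₂)
      exact ⟨⟨_, h₂, Set.inter_subset_left.trans hDC, hs₂⟩, Set.inter_subset_left, c, s, hcs,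
        fun x hx => le_of_lt hx.2⟩
    · refine ⟨⟨_, h₁, Set.inter_subset_left.trans hDC, hs₁⟩, Set.inter_subset_left, -c, -s,
        by simpa using hcs, fun x hx => ?_⟩
      have : c * A x + s * B x < c * q.1 + s * q.2 := hx.2
      linarith
  choose F hFsub hF using hstep
  let D : ℕ → X := fun j => Nat.rec ⟨C, hC, subset_rfl, hbad⟩ F j
  have hanti : Antitone fun j => closure (D j).1 :=
    antitone_nat_of_succ_le fun j => closure_mono (hFsub j (D j))
  have hcomp (j : ℕ) : IsCompact (closure (D j).1) := (D j).2.1.isBounded.isCompact_closure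
  set K : Set E := ⋂ j, closure (D j).1
  have hKconv : Convex ℝ K := convex_iInter fun j => (D j).2.1.convex.closure
  have hint : interior (A.prod B '' K) = ∅ := by
    rw [← Set.not_nonempty_iff_eq_empty]
    intro hne
    obtain ⟨j, hj⟩ := (TopologicalSpace.denseRange_denseSeq (ℝ × ℝ)).exists_mem_open
      isOpen_interior hne
    obtain ⟨c, s, hcs, h⟩ := hF j (D j)
    refine notMem_interior_of_forall_le hcs ?_ hj
    rintro _ ⟨x, hx, rfl⟩
    have hx' : x ∈ closure (D (j + 1)).1 := Set.mem_iInter.1 hx (j + 1)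
    exact closure_minimal (t := {x | c * (TopologicalSpace.denseSeq (ℝ × ℝ) j).1 +
        s * (TopologicalSpace.denseSeq (ℝ × ℝ) j).2 ≤ c * A x + s * B x}) h
      (isClosed_le continuous_const (by fun_prop)) hx'
  obtain ⟨c, s, t, hcs, ht⟩ := (hKconv.linear_image (A.prod B).toLinearMap)
    |>.exists_sq_add_sq_eq_one_of_interior_eq_empty hint
  have hopen : IsOpen {x | |c * A x + s * B x - t| < ε} :=
    isOpen_lt (by fun_prop) continuous_const
  obtain ⟨j, hj⟩ := exists_subset_nhds_of_isCompact (V := fun j => closure (D j).1)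
    hanti.directed_ge hcomp (U := {x | |c * A x + s * B x - t| < ε}) fun x hx =>
      hopen.mem_nhds (by
        have : c * A x + s * B x = t := ht _ (Set.mem_image_of_mem _ hx)
        simpa [this] using hε)
  exact (D j).2.2.2 (.leaf ⟨(D j).2.1, (D j).2.2.1, c, s, t, hcs, fun x hx =>
    le_of_lt (hj (subset_closure hx))⟩)

end Slicing

section Euclidean

variable {n : ℕ} {ε : ℝ}

/-- `IsThin ε k D` says that, in a suitable orthonormal basis, all coordinates of `D` with index
at least `k` vary within intervals of radius `ε`. -/
def IsThin (ε : ℝ) (k : ℕ) (D : Set (EuclideanSpace ℝ (Fin n))) : Prop :=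
  ∃ b : OrthonormalBasis (Fin n) ℝ (EuclideanSpace ℝ (Fin n)), ∀ i : Fin n, k ≤ i →
    ∃ t : ℝ, ∀ x ∈ D, |inner ℝ (b i) x - t| ≤ ε

theorem IsThin.of_inner_smul_add_smul {k : ℕ} (hk : k + 1 < n)
    {D : Set (EuclideanSpace ℝ (Fin n))}
    (b : OrthonormalBasis (Fin n) ℝ (EuclideanSpace ℝ (Fin n)))
    (hb : ∀ i : Fin n, k + 2 ≤ i → ∃ t : ℝ, ∀ x ∈ D, |inner ℝ (b i) x - t| ≤ ε)
    {c s t : ℝ} (hcs : c ^ 2 + s ^ 2 = 1)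
    (ht : ∀ x ∈ D, |c * inner ℝ (b ⟨k, by omega⟩) x + s * inner ℝ (b ⟨k + 1, hk⟩) x - t| ≤ ε) :
    IsThin ε (k + 1) D := by
  set w := c • b ⟨k, by omega⟩ + s • b ⟨k + 1, hk⟩ with hw
  have hbij := orthonormal_iff_ite.1 b.orthonormal
  have hwb (i : Fin n) (hi : k + 2 ≤ (i : ℕ)) : inner ℝ w (b i) = 0 := by
    have h₁ : (⟨k, by omega⟩ : Fin n) ≠ i := Fin.ne_of_val_ne (by simp only; omega)
    have h₂ : (⟨k + 1, hk⟩ : Fin n) ≠ i := Fin.ne_of_val_ne (by simp only; omega)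
    rw [hw, inner_add_left, inner_smul_left, inner_smul_left, hbij, hbij]
    simp [h₁, h₂]
  have hww : inner ℝ w w = (1 : ℝ) := by
    simp only [hw, inner_add_left, inner_add_right, inner_smul_left, inner_smul_right, hbij]
    simp
    linarith
  have horth : Orthonormal ℝ (Set.domRestrict {i : Fin n | k + 1 ≤ (i : ℕ)}
      (Function.update b ⟨k + 1, hk⟩ w)) := by
    rw [orthonormal_iff_ite]
    rintro ⟨i, hi⟩ ⟨j, hj⟩
    have key (i : Fin n) (hi : k + 1 ≤ (i : ℕ)) (hne : i ≠ ⟨k + 1, hk⟩) : k + 2 ≤ (i : ℕ) := by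
      have : (i : ℕ) ≠ k + 1 := fun h => hne (Fin.ext h)
      omega
    simp only [Set.domRestrict_apply, Subtype.mk.injEq]
    by_cases hi' : i = ⟨k + 1, hk⟩ <;> by_cases hj' : j = ⟨k + 1, hk⟩
    · subst hi' hj'; simpa using hww
    · subst hi'
      simp [Function.update_of_ne hj', hwb j (key j hj hj'), Ne.symm hj']
    · subst hj'
      rw [real_inner_comm]
      simp [hwb i (key i hi hi'), hi']
    · rw [Function.update_of_ne hi', Function.update_of_ne hj', hbij]
  obtain ⟨b', hb'⟩ := horth.exists_orthonormalBasis_extension_of_card_eq (by simp)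
  refine ⟨b', fun i hi => ?_⟩
  rw [hb' i hi]
  by_cases hi' : i = ⟨k + 1, hk⟩
  · subst hi'
    refine ⟨t, fun x hx => ?_⟩
    simpa [hw, inner_add_left, inner_smul_left] using ht x hx
  · rw [Function.update_of_ne hi']
    have : (i : ℕ) ≠ k + 1 := fun h => hi' (Fin.ext h)
    exact hb i (by omega)

theorem OrthonormalBasis.linearIndependent_innerSL_pair
    (b : OrthonormalBasis (Fin n) ℝ (EuclideanSpace ℝ (Fin n))) {i j : Fin n} (hij : i ≠ j) :
    LinearIndependent ℝ ![innerSL ℝ (b i), innerSL ℝ (b j)] := by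
  have hbij := orthonormal_iff_ite.1 b.orthonormal
  refine LinearIndependent.pair_iff.2 fun c s h => ⟨?_, ?_⟩
  · simpa [hbij, hij.symm] using DFunLike.congr_fun h (b i)
  · simpa [hbij, hij] using DFunLike.congr_fun h (b j)

theorem IsBalanced.hyperplaneSlicing_isThin {f : EuclideanSpace ℝ (Fin n) → ℝ} (hε : 0 < ε)
    {k : ℕ} (hk : 1 ≤ k) : ∀ {D : Set (EuclideanSpace ℝ (Fin n))}, IsBalanced volume f D →
      IsThin ε k D →
      HyperplaneSlicing (fun D' => IsBalanced volume f D' ∧ IsThin ε 1 D') D := by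
  induction k, hk using Nat.le_induction with
  | base => exact fun hD hthin => .leaf ⟨hD, hthin⟩
  | succ k hk ih =>
    intro D hD ⟨b, hb⟩
    obtain ⟨k, rfl⟩ := Nat.exists_eq_add_of_le' hk
    by_cases hkn : k + 1 < n
    · have hne : (⟨k, by omega⟩ : Fin n) ≠ ⟨k + 1, hkn⟩ := by simp
      refine (hD.hyperplaneSlicing_of_linearIndependent
        (b.linearIndependent_innerSL_pair hne) hε).bind ?_
      rintro D' ⟨hD', hsub, c, s, t, hcs, ht⟩
      refine ih hD' (IsThin.of_inner_smul_add_smul hkn b (fun i hi => ?_) hcs ht)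
      obtain ⟨t, ht⟩ := hb i hi
      exact ⟨t, fun x hx => ht x (hsub hx)⟩
    · exact ih hD ⟨b, fun i hi => absurd i.2 (by omega)⟩

theorem IsThin.exists_isometryEquiv (hn : 0 < n) {D : Set (EuclideanSpace ℝ (Fin n))}
    (hD : IsThin ε 1 D) (hbdd : Bornology.IsBounded D) :
    ∃ T : EuclideanSpace ℝ (Fin n) ≃ᵢ EuclideanSpace ℝ (Fin n),
      T '' D ⊆ {x : EuclideanSpace ℝ (Fin n) | 0 ≤ x ⟨0, hn⟩ ∧ x ⟨0, hn⟩ ≤ Metric.diam D ∧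
        ∀ ℓ : Fin n, ℓ ≠ ⟨0, hn⟩ → |x ℓ| ≤ ε} := by
  obtain ⟨b, hb⟩ := hD
  choose! t ht using hb
  set a : ℝ := sInf ((fun x => inner ℝ (b ⟨0, hn⟩) x) '' D)
  have hdist : ∀ x ∈ D, ∀ y ∈ D,
      inner ℝ (b ⟨0, hn⟩) x - Metric.diam D ≤ inner ℝ (b ⟨0, hn⟩) y := by
    intro x hx y hy
    have h₁ := real_inner_le_norm (b ⟨0, hn⟩) (x - y)
    rw [b.norm_eq_one, one_mul, ← dist_eq_norm, inner_sub_right] at h₁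
    linarith [Metric.dist_le_diam_of_mem hbdd hx hy]
  refine ⟨b.repr.toIsometryEquiv.trans (IsometryEquiv.subRight
    (WithLp.toLp 2 (Function.update t ⟨0, hn⟩ a))), ?_⟩
  rintro _ ⟨x, hx, rfl⟩
  have hbelow : BddBelow ((fun x => inner ℝ (b ⟨0, hn⟩) x) '' D) :=
    ⟨_, Set.forall_mem_image.2 (hdist x hx)⟩
  have hle : a ≤ inner ℝ (b ⟨0, hn⟩) x := csInf_le hbelow (Set.mem_image_of_mem _ hx)
  have hge : inner ℝ (b ⟨0, hn⟩) x - Metric.diam D ≤ a :=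
    le_csInf ⟨_, Set.mem_image_of_mem _ hx⟩ (Set.forall_mem_image.2 (hdist x hx))
  refine ⟨?_, ?_, fun ℓ hℓ => ?_⟩
  · simpa [b.repr_apply_apply] using hle
  · simpa [b.repr_apply_apply, add_comm] using hge
  · have hℓ1 : 1 ≤ (ℓ : ℕ) := Nat.one_le_iff_ne_zero.2 fun h => hℓ (Fin.ext h)
    simpa [b.repr_apply_apply, Function.update_of_ne hℓ] using ht ℓ hℓ1 x hx

end Euclidean

theorem integrableOn_abs_rpow_sub_two_mul {E : Type*} [NormedAddCommGroup E] [NormedSpace ℝ E]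
    [MeasurableSpace E] [BorelSpace E] [FiniteDimensional ℝ E] {μ : Measure E}
    [IsFiniteMeasureOnCompacts μ] {Ω : Set E} (hΩ : IsOpen Ω) (hbdd : Bornology.IsBounded Ω)
    {p : ℝ} (hp : 1 < p) {u : E → ℝ} (hu : ContinuousOn u (closure Ω)) :
    IntegrableOn (fun x => |u x| ^ (p - 2) * u x) Ω μ := by
  obtain ⟨M, hM⟩ := hbdd.isCompact_closure.exists_bound_of_continuousOn hu
  have hmeas : AEMeasurable u (μ.restrict Ω) :=
    (hu.mono subset_closure).aemeasurable hΩ.measurableSet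
  have hfin : IsFiniteMeasure (μ.restrict Ω) :=
    isFiniteMeasure_restrict.2 hbdd.measure_lt_top.ne
  refine Integrable.of_bound (C := M ^ (p - 1))
    ((hmeas.norm.pow_const (p - 2)).mul hmeas).aestronglyMeasurable ?_
  filter_upwards [ae_restrict_mem hΩ.measurableSet] with x hx
  have hux : |u x| ≤ M := hM x (subset_closure hx)
  calc ‖|u x| ^ (p - 2) * u x‖ = |u x| ^ (p - 2) * |u x| := by
        rw [Real.norm_eq_abs, abs_mul, abs_of_nonneg (Real.rpow_nonneg (abs_nonneg _) _)]
    _ = |u x| ^ (p - 1) := by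
        rw [show p - 1 = p - 2 + 1 by ring,
          Real.rpow_add_one' (abs_nonneg _) (by linarith)]
    _ ≤ M ^ (p - 1) := Real.rpow_le_rpow (abs_nonneg _) hux (by linarith)

/-- **Lemma 4.1 (Payne–Weinberger slicing lemma).** Let `Ω ⊂ ℝⁿ` be a bounded open convex set
with diameter `d`, `p > 1`, and `u` continuous on the closure of `Ω` with
`∫_Ω |u|^(p-2) u = 0`. For every `ε > 0` there are finitely many pairwise disjoint open convex
subsets `Ω₁, …, Ω_k` of `Ω` whose closures cover the closure of `Ω`, with
`∫_{Ω_i} |u|^(p-2) u = 0` for each `i`, and each `Ω_i` fits, after a rigid motion, inside the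
slab `{0 ≤ x₁ ≤ d_i, |x_ℓ| ≤ ε (ℓ = 2, …, n)}` for some `d_i ≤ d`. -/
theorem payne_weinberger_slicing
    (n : ℕ) (hn : 0 < n) (Ω : Set (EuclideanSpace ℝ (Fin n)))
    (hΩopen : IsOpen Ω) (hΩconv : Convex ℝ Ω) (hΩbdd : Bornology.IsBounded Ω)
    (p : ℝ) (hp : 1 < p)
    (u : EuclideanSpace ℝ (Fin n) → ℝ) (hu : ContinuousOn u (closure Ω))
    (hmean : ∫ x in Ω, |u x| ^ (p - 2) * u x = 0)
    (ε : ℝ) (hε : 0 < ε) :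
    ∃ (k : ℕ) (Ωs : Fin k → Set (EuclideanSpace ℝ (Fin n))),
      (∀ i, IsOpen (Ωs i)) ∧ (∀ i, Convex ℝ (Ωs i)) ∧ (∀ i, Ωs i ⊆ Ω) ∧
      (Pairwise fun i j => Disjoint (Ωs i) (Ωs j)) ∧
      (⋃ i, closure (Ωs i)) = closure Ω ∧
      (∀ i, ∫ x in Ωs i, |u x| ^ (p - 2) * u x = 0) ∧
      (∀ i, ∃ (T : EuclideanSpace ℝ (Fin n) ≃ᵢ EuclideanSpace ℝ (Fin n)) (d_i : ℝ),
        d_i ≤ Metric.diam Ω ∧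
        T '' Ωs i ⊆ {x : EuclideanSpace ℝ (Fin n) |
          0 ≤ x ⟨0, hn⟩ ∧ x ⟨0, hn⟩ ≤ d_i ∧ ∀ ℓ : Fin n, ℓ ≠ ⟨0, hn⟩ → |x ℓ| ≤ ε}) := by
  have hbal : IsBalanced volume (fun x => |u x| ^ (p - 2) * u x) Ω :=
    ⟨hΩopen, hΩconv, hΩbdd, integrableOn_abs_rpow_sub_two_mul hΩopen hΩbdd hp hu, hmean⟩
  have hthin : IsThin ε n Ω :=
    ⟨EuclideanSpace.basisFun (Fin n) ℝ, fun i hi => absurd i.2 (not_lt.2 hi)⟩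
  obtain ⟨S, hfin, hS, hdisj, hcl⟩ :=
    (hbal.hyperplaneSlicing_isThin hε hn hthin).exists_finite hΩopen
  have := hfin.fintype
  let e := (Fintype.equivFin S).symm
  refine ⟨Fintype.card S, fun i => (e i).1, fun i => (hS _ (e i).2).2.1.isOpen,
    fun i => (hS _ (e i).2).2.1.convex, fun i => (hS _ (e i).2).1, fun i j hij => ?_, ?_,
    fun i => (hS _ (e i).2).2.1.integral_eq_zero, fun i => ?_⟩
  · exact hdisj (e i).2 (e j).2 fun h => hij (e.injective (Subtype.ext h))
  · rw [← hcl, Set.biUnion_eq_iUnion]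
    exact e.iSup_comp (g := fun D : S => closure D.1)
  · obtain ⟨hsub, hD, hDthin⟩ := hS _ (e i).2
    obtain ⟨T, hT⟩ := hDthin.exists_isometryEquiv hn hD.isBounded
    exact ⟨T, _, Metric.diam_mono hsub hΩbdd, hT⟩
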